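/- Let n be a positive integer and let K_p, K_d, K_o ∈ ℝ^{n×n} be symmetric positive definite matrices. Every differentiable triple (I, H̃, ζ) : ℝ → ℝ^n × ℝ^n × ℝ^n satisfying İ = H̃, Ḣ̃ = ζ − K_d H̃ − K_p I, ζ̇ = −ζ − K_o⁻¹H̃ for all t ≥ 0 converges to (0, 0, 0) as t → +∞. This is item 2) of Lemma 2: the equilibrium (I, H̃, ζ) = (0,0,0) is globally asymptotically stable when the parametrisation variable ξ is bounded. -/

import Mathlib

open Matrix Filter

lemma aux_compact (n : ℕ) : IsCompact {x : Fin n → ℝ | x ⬝ᵥ x = 1} := by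
  apply Metric.isCompact_of_isClosed_isBounded
  · exact isClosed_eq (by simp only [dotProduct]; fun_prop) continuous_const
  · refine (Metric.isBounded_closedBall (x := (0 : Fin n → ℝ)) (r := 1)).subset ?_
    intro x hx
    rw [Metric.mem_closedBall, dist_zero_right, pi_norm_le_iff_of_nonneg zero_le_one]
    intro i
    have h1 : x i * x i ≤ x ⬝ᵥ x :=
      Finset.single_le_sum (f := fun i => x i * x i) (fun j _ => mul_self_nonneg _)
        (Finset.mem_univ i)
    have hx' : x ⬝ᵥ x = 1 := hx
    rw [Real.norm_eq_abs]
    refine abs_le_of_sq_le_sq ?_ zero_le_one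
    nlinarith

lemma aux_nonneg {n : ℕ} (x : Fin n → ℝ) : 0 ≤ x ⬝ᵥ x :=
  Finset.sum_nonneg (fun j _ => mul_self_nonneg _)

lemma aux_norm {n : ℕ} (x : Fin n → ℝ) (hx : x ≠ 0) :
    ∃ (s : ℝ) (u : Fin n → ℝ), u ⬝ᵥ u = 1 ∧ s * s = x ⬝ᵥ x ∧ x = s • u := by
  have h0 : x ⬝ᵥ x ≠ 0 := fun h => hx (dotProduct_self_eq_zero.mp h)
  have h1 := aux_nonneg x
  have h2 : √(x ⬝ᵥ x) ≠ 0 := by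
    rw [Real.sqrt_ne_zero h1]; exact h0
  have h3 := Real.mul_self_sqrt h1
  refine ⟨√(x ⬝ᵥ x), (√(x ⬝ᵥ x))⁻¹ • x, ?_, h3, ?_⟩
  · rw [smul_dotProduct, dotProduct_smul, smul_eq_mul, smul_eq_mul]
    field_simp
    nlinarith
  · rw [smul_smul, mul_inv_cancel₀ h2, one_smul]

lemma aux_cont {n : ℕ} (A : Matrix (Fin n) (Fin n) ℝ) :
    Continuous (fun x : Fin n → ℝ => x ⬝ᵥ (A *ᵥ x)) := by
  simp only [dotProduct, mulVec]; fun_prop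

lemma aux_hom {n : ℕ} (A : Matrix (Fin n) (Fin n) ℝ) (s : ℝ) (u : Fin n → ℝ) :
    (s • u) ⬝ᵥ (A *ᵥ (s • u)) = s * s * (u ⬝ᵥ (A *ᵥ u)) := by
  rw [mulVec_smul, smul_dotProduct, dotProduct_smul, smul_eq_mul, smul_eq_mul]; ring

lemma aux_lower {n : ℕ} (A : Matrix (Fin n) (Fin n) ℝ) (hA : A.PosDef) :
    ∃ a > 0, ∀ x : Fin n → ℝ, a * (x ⬝ᵥ x) ≤ x ⬝ᵥ (A *ᵥ x) := by
  obtain ⟨a, ha, h⟩ := (aux_compact n).exists_forall_le' (aux_cont A).continuousOn (a := 0) (by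
    intro b hb
    have hb0 : b ≠ 0 := by
      rintro rfl
      simp at hb
    have := hA.dotProduct_mulVec_pos hb0
    simpa using this)
  refine ⟨a, ha, fun x => ?_⟩
  by_cases hx : x = 0
  · simp [hx]
  obtain ⟨s, u, hu, hs, hxu⟩ := aux_norm x hx
  rw [← hs, hxu, aux_hom]
  have := h u hu
  nlinarith [mul_self_nonneg s]

lemma aux_upper {n : ℕ} (A : Matrix (Fin n) (Fin n) ℝ) :
    ∃ a > 0, ∀ x : Fin n → ℝ, x ⬝ᵥ (A *ᵥ x) ≤ a * (x ⬝ᵥ x) := by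
  obtain ⟨a, h⟩ := (aux_compact n).bddAbove_image (aux_cont A).continuousOn
  refine ⟨max a 1, by positivity, fun x => ?_⟩
  by_cases hx : x = 0
  · simp [hx]
  obtain ⟨s, u, hu, hs, hxu⟩ := aux_norm x hx
  rw [← hs, hxu, aux_hom]
  have := (h ⟨u, hu, rfl⟩).trans (le_max_left a 1)
  nlinarith [mul_self_nonneg s]

lemma aux_deriv_dot {n : ℕ} {f g : ℝ → Fin n → ℝ} {f' g' : Fin n → ℝ} {t : ℝ}
    (hf : HasDerivAt f f' t) (hg : HasDerivAt g g' t) :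
    HasDerivAt (fun t => f t ⬝ᵥ g t) (f' ⬝ᵥ g t + f t ⬝ᵥ g') t := by
  simp only [dotProduct, ← Finset.sum_add_distrib]
  exact HasDerivAt.fun_sum fun i _ => (hasDerivAt_pi.mp hf i).mul (hasDerivAt_pi.mp hg i)

lemma aux_deriv_mulVec {n : ℕ} (A : Matrix (Fin n) (Fin n) ℝ) {g : ℝ → Fin n → ℝ}
    {g' : Fin n → ℝ} {t : ℝ} (hg : HasDerivAt g g' t) :
    HasDerivAt (fun t => A *ᵥ g t) (A *ᵥ g') t := by
  rw [hasDerivAt_pi]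
  intro i
  have := aux_deriv_dot (hasDerivAt_const t (A i)) hg
  simpa [mulVec] using this

lemma aux_symm {n : ℕ} {A : Matrix (Fin n) (Fin n) ℝ} (hA : A.PosDef) (x y : Fin n → ℝ) :
    x ⬝ᵥ (A *ᵥ y) = y ⬝ᵥ (A *ᵥ x) := by
  have h : Aᵀ = A := by simpa using hA.isHermitian.eq
  rw [dotProduct_mulVec, dotProduct_comm, ← mulVec_transpose, h]

lemma aux_deriv_quad {n : ℕ} {A : Matrix (Fin n) (Fin n) ℝ} (hA : A.PosDef)
    {g : ℝ → Fin n → ℝ} {g' : Fin n → ℝ} {t : ℝ} (hg : HasDerivAt g g' t) :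
    HasDerivAt (fun t => g t ⬝ᵥ (A *ᵥ g t)) (2 * (g t ⬝ᵥ (A *ᵥ g'))) t := by
  convert aux_deriv_dot hg (aux_deriv_mulVec A hg) using 1
  rw [aux_symm hA g']; ring

lemma aux_young {n : ℕ} (x y : Fin n → ℝ) (a b : ℝ) :
    0 ≤ a * a * (x ⬝ᵥ x) + 2 * (a * b) * (x ⬝ᵥ y) + b * b * (y ⬝ᵥ y) := by
  have := aux_nonneg (a • x + b • y)
  simp only [dotProduct_add, add_dotProduct, smul_dotProduct, dotProduct_smul, smul_eq_mul,
    dotProduct_comm y x] at this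
  linarith

lemma aux_tendsto {n : ℕ} (f : ℝ → Fin n → ℝ)
    (h : Tendsto (fun t => f t ⬝ᵥ f t) atTop (nhds 0)) : Tendsto f atTop (nhds 0) := by
  rw [tendsto_pi_nhds]
  intro i
  have h1 : Tendsto (fun t => (f t i) ^ 2) atTop (nhds 0) := by
    refine squeeze_zero (fun t => sq_nonneg _) (fun t => ?_) h
    rw [sq]
    exact Finset.single_le_sum (f := fun i => f t i * f t i) (fun j _ => mul_self_nonneg _)
        (Finset.mem_univ i)
  have h2 := h1.sqrt
  simp only [Real.sqrt_sq_eq_abs, Real.sqrt_zero] at h2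
  exact (tendsto_zero_iff_abs_tendsto_zero _).mpr h2

lemma aux_decay (W W' N : ℝ → ℝ) (hW : ∀ t, HasDerivAt W (W' t) t) (b c C : ℝ) (hb : 0 < b)
    (hc : 0 < c) (hC : 0 < C) (hN : ∀ t, 0 ≤ N t) (hlow : ∀ t, b * N t ≤ W t)
    (hup : ∀ t, W t ≤ C * N t) (hd : ∀ t, 0 ≤ t → W' t ≤ -c * N t) :
    Tendsto N atTop (nhds 0) := by
  have hE : ∀ t, HasDerivAt (fun t => W t * Real.exp (c / C * t))
      (W' t * Real.exp (c / C * t) + W t * (Real.exp (c / C * t) * (c / C))) t := by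
    intro t
    have := ((hasDerivAt_id t).const_mul (c / C)).exp
    simp only [id, mul_one] at this
    exact (hW t).mul this
  have hanti : AntitoneOn (fun t => W t * Real.exp (c / C * t)) (Set.Ici 0) := by
    apply antitoneOn_of_deriv_nonpos (convex_Ici 0)
    · exact fun t _ => (hE t).continuousAt.continuousWithinAt
    · exact fun t _ => (hE t).differentiableAt.differentiableWithinAt
    · intro t ht
      rw [interior_Ici] at ht
      rw [(hE t).deriv]
      have h1 := hd t (le_of_lt ht)
      have h2 : c / C * W t ≤ c * N t := by
        have := mul_le_mul_of_nonneg_left (hup t) (div_pos hc hC).le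
        rwa [← mul_assoc, div_mul_cancel₀ _ hC.ne'] at this
      have h3 := Real.exp_pos (c / C * t)
      have : (W' t + c / C * W t) * Real.exp (c / C * t) ≤ 0 :=
        mul_nonpos_of_nonpos_of_nonneg (by linarith) h3.le
      linarith
  have hlim : Tendsto (fun t => W 0 / b * Real.exp (-(c / C * t))) atTop (nhds 0) := by
    have : Tendsto (fun t : ℝ => c / C * t) atTop atTop :=
      tendsto_id.const_mul_atTop (div_pos hc hC)
    have := (Real.tendsto_exp_neg_atTop_nhds_zero.comp this).const_mul (W 0 / b)
    simpa using this
  refine squeeze_zero' (Eventually.of_forall hN) ?_ hlim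
  filter_upwards [eventually_ge_atTop 0] with t ht
  have h := hanti (Set.mem_Ici.mpr le_rfl) (Set.mem_Ici.mpr ht) ht
  simp only [mul_zero, Real.exp_zero, mul_one] at h
  have h3 := Real.exp_pos (c / C * t)
  rw [Real.exp_neg, ← div_eq_mul_inv, div_div, le_div_iff₀ (by positivity)]
  have := mul_le_mul_of_nonneg_right (hlow t) h3.le
  linarith

/-- item 2 of Lemma 2: For symmetric positive definite `K_p, K_d, K_o`,
every differentiable triple `(I, H̃, ζ)` satisfying the closed-loop system
`İ = H̃`, `Ḣ̃ = ζ - K_d H̃ - K_p I`, `ζ̇ = -ζ - K_o⁻¹ H̃` for all `t ≥ 0`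
converges to `(0, 0, 0)` as `t → +∞`: the equilibrium `(I, H̃, ζ) = (0,0,0)` is
globally asymptotically stable. -/
theorem momentum_jerk_with_integral_tendsto_zero
    (n : ℕ) (hn : 0 < n) (Kp Kd Ko : Matrix (Fin n) (Fin n) ℝ)
    (hKp : Kp.PosDef) (hKd : Kd.PosDef) (hKo : Ko.PosDef)
    (I H Z I' H' Z' : ℝ → (Fin n → ℝ))
    (hI : ∀ t, HasDerivAt I (I' t) t)
    (hH : ∀ t, HasDerivAt H (H' t) t)
    (hZ : ∀ t, HasDerivAt Z (Z' t) t)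
    (hI' : ∀ t, 0 ≤ t → I' t = H t)
    (hH' : ∀ t, 0 ≤ t → H' t = Z t - Kd *ᵥ H t - Kp *ᵥ I t)
    (hZ' : ∀ t, 0 ≤ t → Z' t = -(Z t) - Ko⁻¹ *ᵥ H t) :
    Tendsto I atTop (nhds 0) ∧ Tendsto H atTop (nhds 0) ∧ Tendsto Z atTop (nhds 0) := by
  obtain ⟨a1, ha1, hl1⟩ := aux_lower Kp hKp
  obtain ⟨a2, ha2, hl2⟩ := aux_lower Kd hKd
  obtain ⟨a3, ha3, hl3⟩ := aux_lower Ko hKo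
  obtain ⟨M1, hM1, hu1⟩ := aux_upper Kp
  obtain ⟨M2, hM2, hu2⟩ := aux_upper Kd
  obtain ⟨M3, hM3, hu3⟩ := aux_upper Ko
  obtain ⟨a, ha, h1, h2, h3, h4⟩ : ∃ a : ℝ, 0 < a ∧ a ≤ a1 ∧ a ≤ a2 ∧ a ≤ a3 ∧ a ≤ 1 :=
    ⟨min (min a1 a2) (min a3 1), by positivity, by simp, by simp, by simp, by simp⟩
  have ha2' : a ^ 2 ≤ a := by nlinarith
  -- ε = a²/2
  set e : ℝ := a ^ 2 / 2 with he
  have he0 : 0 < e := by positivity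
  have hea : e ≤ a / 2 := by linarith
  have hN := fun (x : Fin n → ℝ) => aux_nonneg x
  have hdet : IsUnit Ko.det := hKo.det_pos.ne'.isUnit
  have key : Tendsto (fun t => I t ⬝ᵥ I t + H t ⬝ᵥ H t + Z t ⬝ᵥ Z t) atTop (nhds 0) := by
    apply aux_decay
      (fun t => 1 / 2 * (I t ⬝ᵥ (Kp *ᵥ I t)) + 1 / 2 * (H t ⬝ᵥ H t)
        + 1 / 2 * (Z t ⬝ᵥ (Ko *ᵥ Z t)) + e * (I t ⬝ᵥ H t) + e / 2 * (I t ⬝ᵥ (Kd *ᵥ I t)))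
      _ _ (fun t => (((((aux_deriv_quad hKp (hI t)).const_mul (1 / 2)).add
        ((aux_deriv_dot (hH t) (hH t)).const_mul (1 / 2))).add
        ((aux_deriv_quad hKo (hZ t)).const_mul (1 / 2))).add
        ((aux_deriv_dot (hI t) (hH t)).const_mul e)).add
        ((aux_deriv_quad hKd (hI t)).const_mul (e / 2)))
      (a / 4) (e * a / 2) (M1 + M2 + M3 + 1) (by positivity) (by positivity) (by positivity)
    · intro t
      linarith [hN (I t), hN (H t), hN (Z t)]
    · intro t
      have y := aux_young (I t) (H t) 1 1
      have z1 := (mul_le_mul_of_nonneg_right h1 (hN (I t))).trans (hl1 (I t))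
      have z3 := (mul_le_mul_of_nonneg_right h3 (hN (Z t))).trans (hl3 (Z t))
      have z2 := (mul_nonneg ha2.le (hN (I t))).trans (hl2 (I t))
      have w := mul_nonneg he0.le y
      have w2 := mul_nonneg he0.le z2
      have w3 := mul_le_mul_of_nonneg_right hea (hN (I t))
      have w4 := mul_le_mul_of_nonneg_right hea (hN (H t))
      have w5 := mul_le_mul_of_nonneg_right h4 (hN (H t))
      have w6 := mul_nonneg ha.le (hN (Z t))
      linarith
    · intro t
      have y := aux_young (I t) (H t) 1 (-1)
      have w := mul_nonneg he0.le y
      have hM := mul_nonneg hM1.le (hN (I t))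
      have e1 : e ≤ 1 / 2 := by linarith
      have w3 := mul_le_mul_of_nonneg_right e1 (hN (I t))
      have w4 := mul_le_mul_of_nonneg_right e1 (hN (H t))
      have q2 : e / 2 * (I t ⬝ᵥ (Kd *ᵥ I t)) ≤ 1 * (M2 * (I t ⬝ᵥ I t)) := by
        have r1 := mul_le_mul_of_nonneg_left (hu2 (I t)) (half_pos he0).le
        have r2 := mul_nonneg hM2.le (hN (I t))
        have r3 := mul_le_mul_of_nonneg_right (show e / 2 ≤ 1 by linarith) r2
        linarith
      have q1 := hu1 (I t)
      have q3 := hu3 (Z t)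
      have := hN (I t)
      have := hN (H t)
      have := hN (Z t)
      have p1 := mul_nonneg (add_pos hM1 (add_pos hM2 hM3)).le (hN (H t))
      have p2 := mul_nonneg (add_pos hM1 hM2).le (hN (Z t))
      have p3 := mul_nonneg hM3.le (hN (I t))
      have p4 := mul_nonneg hM3.le (hN (Z t))
      linarith
    · intro t ht
      rw [hI' t ht, hH' t ht, hZ' t ht]
      have hKK : Ko *ᵥ (Ko⁻¹ *ᵥ H t) = H t := by
        rw [mulVec_mulVec, mul_nonsing_inv _ hdet, one_mulVec]
      simp only [mulVec_sub, mulVec_neg, hKK, dotProduct_sub, sub_dotProduct, dotProduct_neg]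
      rw [dotProduct_comm (Kd *ᵥ H t) (H t), dotProduct_comm (Kp *ᵥ I t) (H t),
        aux_symm hKp (H t) (I t), dotProduct_comm (Z t) (H t)]
      have z1 := mul_le_mul_of_nonneg_left
        ((mul_le_mul_of_nonneg_right h1 (hN (I t))).trans (hl1 (I t))) he0.le
      have z2 := (mul_le_mul_of_nonneg_right h2 (hN (H t))).trans (hl2 (H t))
      have z3 := (mul_le_mul_of_nonneg_right h3 (hN (Z t))).trans (hl3 (Z t))
      have y := mul_nonneg (half_pos ha).le (aux_young (I t) (Z t) a (-1))
      -- y : 0 ≤ a/2 (a² I² - 2 a I·Z + Z²)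
      have w4 := mul_le_mul_of_nonneg_right hea (hN (H t))
      have ea : e * a / 2 ≤ a / 4 := by nlinarith
      have v1 := mul_le_mul_of_nonneg_right ea (hN (H t))
      have v2 := mul_le_mul_of_nonneg_right ea (hN (Z t))
      have v3 := mul_nonneg ha.le (hN (H t))
      have v4 := mul_nonneg ha.le (hN (Z t))
      have y2 : e * (I t ⬝ᵥ Z t) ≤ e * a / 2 * (I t ⬝ᵥ I t) + a / 4 * (Z t ⬝ᵥ Z t) := by
        rw [he]
        linarith
      linarith
  have hle : ∀ (f : ℝ → Fin n → ℝ),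
      (∀ t, f t ⬝ᵥ f t ≤ I t ⬝ᵥ I t + H t ⬝ᵥ H t + Z t ⬝ᵥ Z t) → Tendsto f atTop (nhds 0) :=
    fun f hf => aux_tendsto f (squeeze_zero (fun t => hN _) hf key)
  refine ⟨hle I fun t => ?_, hle H fun t => ?_, hle Z fun t => ?_⟩ <;>
    linarith [hN (I t), hN (H t), hN (Z t)]
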